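/- arXiv:2404.18338 — 2 statements merged into one kernel-verified Lean document; each statement's English description precedes it below -/
import Mathlib

section
/- The stiffness bilinear form A = M + J of the extended box discrete fracture method is symmetric, and its quadratic form is positive semidefinite: assuming K ∈ ℝ^{n×n} symmetric positive definite, w(T) > 0 for every T ∈ 𝒯, and c(e) ≥ 0 for every e ∈ E, one has A(u,v) = A(v,u) and A(v,v) ≥ 0 for all u, v ∈ ℝ^N. -/
open Matrix

/-- The diffusion bilinear form of the box method. -/
noncomputable def diffusionForm {N n : ℕ} {𝒯 : Type*} [Fintype 𝒯]
    (w : 𝒯 → ℝ) (g : 𝒯 → (Fin N → ℝ) →ₗ[ℝ] (Fin n → ℝ))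
    (K : Matrix (Fin n) (Fin n) ℝ) (u v : Fin N → ℝ) : ℝ :=
  ∑ T, w T * (K.mulVec (g T u) ⬝ᵥ g T v)

/-- The barrier (jump) bilinear form of the extended box discrete fracture method. -/
noncomputable def barrierForm {N : ℕ} {E : Type*} [Fintype E]
    (ap am bp bm : E → Fin N) (c : E → ℝ) (u v : Fin N → ℝ) : ℝ :=
  ∑ e, c e *
    ((u (ap e) - u (am e)) *
        ((3 / 4) * (v (ap e) - v (am e)) + (1 / 4) * (v (bp e) - v (bm e))) +
      (u (bp e) - u (bm e)) *
        ((1 / 4) * (v (ap e) - v (am e)) + (3 / 4) * (v (bp e) - v (bm e))))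

/-- The stiffness bilinear form `A = M + J` of the extended box discrete fracture
method. -/
noncomputable def stiffnessForm {N n : ℕ} {𝒯 E : Type*} [Fintype 𝒯] [Fintype E]
    (w : 𝒯 → ℝ) (g : 𝒯 → (Fin N → ℝ) →ₗ[ℝ] (Fin n → ℝ))
    (K : Matrix (Fin n) (Fin n) ℝ)
    (ap am bp bm : E → Fin N) (c : E → ℝ) (u v : Fin N → ℝ) : ℝ :=
  diffusionForm w g K u v + barrierForm ap am bp bm c u v

theorem diffusionForm_comm {N n : ℕ} {𝒯 : Type*} [Fintype 𝒯]
    (w : 𝒯 → ℝ) (g : 𝒯 → (Fin N → ℝ) →ₗ[ℝ] (Fin n → ℝ))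
    {K : Matrix (Fin n) (Fin n) ℝ} (hK : K.IsSymm) (u v : Fin N → ℝ) :
    diffusionForm w g K u v = diffusionForm w g K v u := by
  refine Finset.sum_congr rfl fun T _ => ?_
  rw [dotProduct_comm, dotProduct_mulVec, ← mulVec_transpose, hK.eq]

theorem diffusionForm_self_nonneg {N n : ℕ} {𝒯 : Type*} [Fintype 𝒯]
    {w : 𝒯 → ℝ} (hw : ∀ T, 0 ≤ w T) (g : 𝒯 → (Fin N → ℝ) →ₗ[ℝ] (Fin n → ℝ))
    {K : Matrix (Fin n) (Fin n) ℝ} (hK : K.PosSemidef) (v : Fin N → ℝ) :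
    0 ≤ diffusionForm w g K v v := by
  refine Finset.sum_nonneg fun T _ => mul_nonneg (hw T) ?_
  rw [dotProduct_comm]
  simpa using hK.dotProduct_mulVec_nonneg (g T v)

theorem barrierForm_comm {N : ℕ} {E : Type*} [Fintype E]
    (ap am bp bm : E → Fin N) (c : E → ℝ) (u v : Fin N → ℝ) :
    barrierForm ap am bp bm c u v = barrierForm ap am bp bm c v u :=
  Finset.sum_congr rfl fun _ _ => by ring

theorem barrierForm_self_nonneg {N : ℕ} {E : Type*} [Fintype E]
    (ap am bp bm : E → Fin N) {c : E → ℝ} (hc : ∀ e, 0 ≤ c e) (v : Fin N → ℝ) :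
    0 ≤ barrierForm ap am bp bm c v v := by
  refine Finset.sum_nonneg fun e _ => mul_nonneg (hc e) ?_
  generalize v (ap e) - v (am e) = x
  generalize v (bp e) - v (bm e) = y
  nlinarith [sq_nonneg x, sq_nonneg y, sq_nonneg (x + y)]

/-- The stiffness bilinear form of the extended box discrete fracture method is
symmetric and its quadratic form is positive semidefinite. -/
theorem stiffnessForm_symm_and_nonneg {N n : ℕ} (hN : 1 ≤ N) (hn : 1 ≤ n)
    {𝒯 E : Type*} [Fintype 𝒯] [Fintype E]
    (w : 𝒯 → ℝ) (hw : ∀ T, 0 < w T)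
    (g : 𝒯 → (Fin N → ℝ) →ₗ[ℝ] (Fin n → ℝ))
    (K : Matrix (Fin n) (Fin n) ℝ) (hK : K.PosDef)
    (ap am bp bm : E → Fin N) (c : E → ℝ) (hc : ∀ e, 0 ≤ c e) :
    (∀ u v : Fin N → ℝ,
        stiffnessForm w g K ap am bp bm c u v = stiffnessForm w g K ap am bp bm c v u) ∧
      ∀ v : Fin N → ℝ, 0 ≤ stiffnessForm w g K ap am bp bm c v v := by
  have hKsymm : K.IsSymm := by simpa [IsHermitian, IsSymm] using hK.isHermitian
  exact ⟨fun u v => congrArg₂ (· + ·) (diffusionForm_comm w g hKsymm u v)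
      (barrierForm_comm ap am bp bm c u v),
    fun v => add_nonneg (diffusionForm_self_nonneg (fun T => (hw T).le) g hK.posSemidef v)
      (barrierForm_self_nonneg ap am bp bm hc v)⟩
end

section
/- Under the connectivity hypothesis (if g_T(v) = 0 for every cell T ∈ 𝒯 and J_a(e,v) = J_b(e,v) = 0 for every edge e ∈ E, then v is a constant vector, i.e., all its entries are equal), and with K ∈ ℝ^{n×n} symmetric positive definite, w(T) > 0 for all T, and c(e) > 0 for all e, the stiffness quadratic form A(v,v) = M(v,v) + J(v,v) vanishes only on constant vectors: A(v,v) = 0 implies that all entries of v are equal. -/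
open Matrix

/-- The quadratic form of a positive definite real matrix is positive off zero. -/
theorem Matrix.PosDef.mulVec_dotProduct_self_pos {n : ℕ} {K : Matrix (Fin n) (Fin n) ℝ}
    (hK : K.PosDef) {x : Fin n → ℝ} (hx : x ≠ 0) : 0 < K.mulVec x ⬝ᵥ x := by
  simpa [dotProduct_comm] using hK.dotProduct_mulVec_pos hx

theorem Matrix.PosDef.mulVec_dotProduct_self_nonneg {n : ℕ} {K : Matrix (Fin n) (Fin n) ℝ}
    (hK : K.PosDef) (x : Fin n → ℝ) : 0 ≤ K.mulVec x ⬝ᵥ x := by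
  by_cases hx : x = 0
  · simp [hx]
  · exact (hK.mulVec_dotProduct_self_pos hx).le

/-- The local jump quadratic form on an edge is a sum of squares. -/
theorem jump_quadratic_eq (a b : ℝ) :
    a * ((3 / 4) * a + (1 / 4) * b) + b * ((1 / 4) * a + (3 / 4) * b) =
      (a ^ 2 + b ^ 2) / 2 + (a + b) ^ 2 / 4 := by
  ring

theorem jump_quadratic_nonneg (a b : ℝ) :
    0 ≤ a * ((3 / 4) * a + (1 / 4) * b) + b * ((1 / 4) * a + (3 / 4) * b) := by
  rw [jump_quadratic_eq]
  positivity

theorem eq_zero_of_jump_quadratic_eq_zero {a b : ℝ}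
    (h : a * ((3 / 4) * a + (1 / 4) * b) + b * ((1 / 4) * a + (3 / 4) * b) = 0) :
    a = 0 ∧ b = 0 := by
  rw [jump_quadratic_eq] at h
  constructor <;> refine pow_eq_zero_iff two_ne_zero |>.1 ?_ <;>
    linarith [sq_nonneg a, sq_nonneg b, sq_nonneg (a + b)]

/-- Under a connectivity hypothesis, the stiffness quadratic form
`A(v,v) = M(v,v) + J(v,v)` of the extended box discrete fracture method vanishes only
on constant vectors. -/
theorem stiffness_quadratic_zero_implies_const {N n : ℕ} (hN : 1 ≤ N) (hn : 1 ≤ n)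
    {𝒯 E : Type*} [Fintype 𝒯] [Fintype E]
    (w : 𝒯 → ℝ) (hw : ∀ T, 0 < w T)
    (g : 𝒯 → (Fin N → ℝ) →ₗ[ℝ] (Fin n → ℝ))
    (K : Matrix (Fin n) (Fin n) ℝ) (hK : K.PosDef)
    (ap am bp bm : E → Fin N) (c : E → ℝ) (hc : ∀ e, 0 < c e)
    (hconn : ∀ v : Fin N → ℝ, (∀ T, g T v = 0) →
      (∀ e, v (ap e) - v (am e) = 0 ∧ v (bp e) - v (bm e) = 0) →
      ∀ i j, v i = v j)
    (v : Fin N → ℝ)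
    (hzero : diffusionForm w g K v v + barrierForm ap am bp bm c v v = 0) :
    ∀ i j, v i = v j := by
  have hM : ∀ T ∈ Finset.univ, 0 ≤ w T * (K.mulVec (g T v) ⬝ᵥ g T v) := fun T _ =>
    mul_nonneg (hw T).le (hK.mulVec_dotProduct_self_nonneg _)
  have hJ := fun (e : E) (_ : e ∈ Finset.univ) => mul_nonneg (hc e).le
    (jump_quadratic_nonneg (v (ap e) - v (am e)) (v (bp e) - v (bm e)))
  obtain ⟨hM0, hJ0⟩ :=
    (add_eq_zero_iff_of_nonneg (Finset.sum_nonneg hM) (Finset.sum_nonneg hJ)).1 hzero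
  refine hconn v (fun T => ?_) fun e => ?_
  · by_contra hT
    exact (mul_pos (hw T) (hK.mulVec_dotProduct_self_pos hT)).ne'
      ((Finset.sum_eq_zero_iff_of_nonneg hM).1 hM0 T (Finset.mem_univ T))
  · have he := (Finset.sum_eq_zero_iff_of_nonneg hJ).1 hJ0 e (Finset.mem_univ e)
    exact eq_zero_of_jump_quadratic_eq_zero ((mul_eq_zero.1 he).resolve_left (hc e).ne')
end
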